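/- arXiv:1806.00693 — 2 statements merged into one kernel-verified Lean document; each statement's English description precedes it below -/
import Mathlib

section
/- Let f_1, f_2 : [0,1] → [0,1] be the piecewise linear maps defined by f_1(x) = 4x for x ∈ [0, 1/4] and f_1(x) = 5/4 − x for x ∈ [1/4, 1]; f_2(x) = 1/4 − x for x ∈ [0, 1/4], f_2(x) = 4x − 1 for x ∈ [1/4, 1/2], and f_2(x) = 2 − 2x for x ∈ [1/2, 1]. Then the composition g = f_2 ∘ f_1 is F-sensitive for the Furstenberg family F of all infinite subsets of ℤ⁺; that is, there exists δ > 0 such that for every x ∈ [0,1] and every open neighborhood U of x in [0,1] there exists y ∈ U with d(g^n(x), g^n(y)) > δ for infinitely many n ∈ ℕ. -/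
open unitInterval

/-- `f₁(x) = 4x` on `[0,1/4]`, `f₁(x) = 5/4 - x` on `[1/4,1]`. -/
noncomputable def tentF₁ : unitInterval → unitInterval := fun x =>
  ⟨if (x : ℝ) ≤ 1/4 then 4 * (x : ℝ) else 5/4 - (x : ℝ), by
    obtain ⟨x, hx0, hx1⟩ := x
    dsimp only
    split_ifs with h <;> constructor <;> nlinarith⟩

/-- `f₂(x) = 1/4 - x` on `[0,1/4]`, `f₂(x) = 4x - 1` on `[1/4,1/2]`,
`f₂(x) = 2 - 2x` on `[1/2,1]`. -/
noncomputable def tentF₂ : unitInterval → unitInterval := fun x =>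
  ⟨if (x : ℝ) ≤ 1/4 then 1/4 - (x : ℝ)
   else if (x : ℝ) ≤ 1/2 then 4 * (x : ℝ) - 1 else 2 - 2 * (x : ℝ), by
    obtain ⟨x, hx0, hx1⟩ := x
    dsimp only
    split_ifs with h h' <;> constructor <;> nlinarith⟩

/-- The composition as a real function. -/
noncomputable def compG (x : ℝ) : ℝ :=
  if x ≤ 1/16 then 1/4 - 4 * x else if x ≤ 1/8 then 16 * x - 1 else
  if x ≤ 1/4 then 2 - 8 * x else if x ≤ 3/4 then 2 * x - 1/2 else 4 - 4 * x

theorem coe_comp (x : unitInterval) : ((tentF₂ (tentF₁ x) : unitInterval) : ℝ) = compG x := by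
  obtain ⟨x, h0, h1⟩ := x
  simp only [tentF₁, tentF₂, compG]
  split_ifs <;> linarith

theorem coe_iter (n : ℕ) (x : unitInterval) :
    (((tentF₂ ∘ tentF₁)^[n] x : unitInterval) : ℝ) = compG^[n] x := by
  induction n generalizing x with
  | zero => rfl
  | succ n ih =>
    rw [Function.iterate_succ_apply, Function.iterate_succ_apply, ih, Function.comp_apply, coe_comp]

theorem G1 {x : ℝ} (h : x ≤ 1/16) : compG x = 1/4 - 4 * x := by simp [compG, show x ≤ 16⁻¹ by linarith]
theorem G2 {x : ℝ} (h : 1/16 ≤ x) (h' : x ≤ 1/8) : compG x = 16 * x - 1 := by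
  unfold compG; split_ifs <;> linarith
theorem G3 {x : ℝ} (h : 1/8 ≤ x) (h' : x ≤ 1/4) : compG x = 2 - 8 * x := by
  unfold compG; split_ifs <;> linarith
theorem G4 {x : ℝ} (h : 1/4 ≤ x) (h' : x ≤ 3/4) : compG x = 2 * x - 1/2 := by
  unfold compG; split_ifs <;> linarith
theorem G5 {x : ℝ} (h : 3/4 ≤ x) : compG x = 4 - 4 * x := by
  unfold compG; split_ifs <;> linarith

/-- Some point of `[a,b]` is eventually mapped to `t`. -/
def Hit (t a b : ℝ) : Prop := ∃ y, a ≤ y ∧ y ≤ b ∧ ∃ m : ℕ, compG^[m] y = t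

theorem Hit.mono {t a b c d : ℝ} (h : Hit t c d) (h1 : a ≤ c) (h2 : d ≤ b) : Hit t a b := by
  obtain ⟨y, hy, hy', m, hm⟩ := h
  exact ⟨y, by linarith, by linarith, m, hm⟩

theorem Hit.pull {t a b c d : ℝ} (h : Hit t c d)
    (H : ∀ z, c ≤ z → z ≤ d → ∃ y, a ≤ y ∧ y ≤ b ∧ compG y = z) : Hit t a b := by
  obtain ⟨z, hz, hz', m, hm⟩ := h
  obtain ⟨y, hy, hy', e⟩ := H z hz hz'
  exact ⟨y, hy, hy', m + 1, by rw [Function.iterate_succ_apply, e, hm]⟩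

theorem pull1 {t a b : ℝ} (hb : b ≤ 1/16) (h : Hit t (1/4 - 4*b) (1/4 - 4*a)) : Hit t a b :=
  h.pull fun z _ _ => ⟨(1/4 - z)/4, by linarith, by linarith, by rw [G1] <;> linarith⟩
theorem pull2 {t a b : ℝ} (ha : 1/16 ≤ a) (hb : b ≤ 1/8) (h : Hit t (16*a-1) (16*b-1)) : Hit t a b :=
  h.pull fun z _ _ => ⟨(z+1)/16, by linarith, by linarith, by rw [G2] <;> linarith⟩
theorem pull3 {t a b : ℝ} (ha : 1/8 ≤ a) (hb : b ≤ 1/4) (h : Hit t (2-8*b) (2-8*a)) : Hit t a b :=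
  h.pull fun z _ _ => ⟨(2-z)/8, by linarith, by linarith, by rw [G3] <;> linarith⟩
theorem pull4 {t a b : ℝ} (ha : 1/4 ≤ a) (hb : b ≤ 3/4) (h : Hit t (2*a-1/2) (2*b-1/2)) : Hit t a b :=
  h.pull fun z _ _ => ⟨(z+1/2)/2, by linarith, by linarith, by rw [G4] <;> linarith⟩
theorem pull5 {t a b : ℝ} (ha : 3/4 ≤ a) (h : Hit t (4-4*b) (4-4*a)) : Hit t a b :=
  h.pull fun z _ _ => ⟨(4-z)/4, by linarith, by linarith, by rw [G5] <;> linarith⟩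

theorem hit_half_zero (k : ℕ) : ∀ c : ℝ, 1/8 ≤ 32^k * c → Hit (1/2) 0 c := by
  have big : ∀ c : ℝ, 1/64 ≤ c → Hit (1/2) 0 c := fun c hc =>
    ⟨1/64, by norm_num, hc, 2, by
      rw [Function.iterate_succ_apply, Function.iterate_one, G1 (x := 1/64) (by norm_num), G3] <;> norm_num⟩
  induction k with
  | zero => intro c hc; exact big c (by linarith)
  | succ k ih =>
    intro c hc
    rcases le_total (1/64) c with h | h
    · exact big c h
    · refine pull1 (by linarith) (pull3 (by linarith) (by linarith) ?_)
      exact (ih (32*c) (by rw [pow_succ] at hc; linarith)).mono (by linarith) (by linarith)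

theorem hit_half (c : ℝ) (hc : 0 < c) : Hit (1/2) 0 c := by
  obtain ⟨k, hk⟩ := pow_unbounded_of_one_lt (1/8/c) (show (1:ℝ) < 32 by norm_num)
  refine hit_half_zero k c ?_
  rw [div_lt_iff₀ hc] at hk
  exact hk.le

theorem hit_all {t : ℝ} (H0 : ∀ c : ℝ, 0 < c → Hit t 0 c) (k : ℕ) :
    ∀ a b : ℝ, 0 ≤ a → b ≤ 1 → 1 ≤ 2^k * (b - a) → Hit t a b := by
  have H1 : ∀ c : ℝ, c < 1 → Hit t c 1 := by
    intro c hc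
    have : Hit t (max c (3/4)) 1 := by
      refine pull5 (le_max_right _ _) ((H0 (4 - 4 * max c (3/4)) ?_).mono (by linarith) le_rfl)
      have : max c (3/4) < 1 := max_lt hc (by norm_num)
      linarith
    exact this.mono (le_max_left _ _) le_rfl
  induction k with
  | zero => intro a b ha hb h; exact (H0 b (by linarith)).mono (by linarith) le_rfl
  | succ k ih =>
    intro a b ha hb h
    have h2 : 1 ≤ 2^k * (2 * (b - a)) := by rw [pow_succ] at h; linarith
    have hpos : (0:ℝ) < 2^k := by positivity
    have hab : 0 < b - a := by
      by_contra hn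
      have := mul_nonpos_of_nonneg_of_nonpos hpos.le (show 2 * (b - a) ≤ 0 by linarith)
      linarith
    have step : ∀ c d : ℝ, 0 ≤ c → d ≤ 1 → 2 * (b - a) ≤ d - c → Hit t c d := fun c d hc hd hh =>
      ih c d hc hd (h2.trans (mul_le_mul_of_nonneg_left hh hpos.le))
    by_cases p1 : a < 1/16 ∧ 1/16 < b
    · have : Hit t (1/16) (min b (1/8)) := by
        have : 1/16 < min b (1/8) := lt_min p1.2 (by norm_num)
        exact pull2 le_rfl (min_le_right _ _) ((H0 _ (by linarith)).mono (by norm_num) le_rfl)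
      exact this.mono p1.1.le (min_le_left _ _)
    by_cases p2 : a < 1/8 ∧ 1/8 < b
    · have : Hit t (1/8) (min b (1/4)) := by
        have : 1/8 < min b (1/4) := lt_min p2.2 (by norm_num)
        exact pull3 le_rfl (min_le_right _ _) ((H1 _ (by linarith)).mono le_rfl (by norm_num))
      exact this.mono p2.1.le (min_le_left _ _)
    by_cases p3 : a < 1/4 ∧ 1/4 < b
    · have : Hit t (1/4) (min b (3/4)) := by
        have : 1/4 < min b (3/4) := lt_min p3.2 (by norm_num)
        exact pull4 le_rfl (min_le_right _ _) ((H0 _ (by linarith)).mono (by norm_num) le_rfl)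
      exact this.mono p3.1.le (min_le_left _ _)
    by_cases p4 : a < 3/4 ∧ 3/4 < b
    · have : Hit t (3/4) b := pull5 le_rfl ((H1 _ (by linarith)).mono le_rfl (by norm_num))
      exact this.mono p4.1.le le_rfl
    rcases le_or_gt b (1/16) with q1 | q1
    · exact pull1 q1 (step _ _ (by linarith) (by linarith) (by linarith))
    have r1 : 1/16 ≤ a := by by_contra hh; exact p1 ⟨by linarith, q1⟩
    rcases le_or_gt b (1/8) with q2 | q2
    · exact pull2 r1 q2 (step _ _ (by linarith) (by linarith) (by linarith))
    have r2 : 1/8 ≤ a := by by_contra hh; exact p2 ⟨by linarith, q2⟩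
    rcases le_or_gt b (1/4) with q3 | q3
    · exact pull3 r2 q3 (step _ _ (by linarith) (by linarith) (by linarith))
    have r3 : 1/4 ≤ a := by by_contra hh; exact p3 ⟨by linarith, q3⟩
    rcases le_or_gt b (3/4) with q4 | q4
    · exact pull4 r3 q4 (step _ _ (by linarith) (by linarith) (by linarith))
    have r4 : 3/4 ≤ a := by by_contra hh; exact p4 ⟨by linarith, q4⟩
    exact pull5 r4 (step _ _ (by linarith) (by linarith) (by linarith))

theorem hit_ab {t : ℝ} (H0 : ∀ c : ℝ, 0 < c → Hit t 0 c) (a b : ℝ) (ha : 0 ≤ a) (hb : b ≤ 1)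
    (hab : a < b) : Hit t a b := by
  obtain ⟨k, hk⟩ := pow_unbounded_of_one_lt (1/(b-a)) (show (1:ℝ) < 2 by norm_num)
  refine hit_all H0 k a b ha hb ?_
  rw [div_lt_iff₀ (by linarith)] at hk
  exact hk.le

theorem iter_half (n : ℕ) : compG^[n] (1/2) = 1/2 :=
  Function.iterate_fixed (by rw [G4] <;> norm_num) n

theorem iter_zero (n : ℕ) : compG^[n] 0 ≤ 1/4 := by
  have : compG^[n] 0 = 0 ∨ compG^[n] 0 = 1/4 := by
    induction n with
    | zero => left; rfl
    | succ n ih =>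
      rw [Function.iterate_succ_apply']
      rcases ih with h | h <;> rw [h]
      · right; rw [G1] <;> norm_num
      · left; rw [G3] <;> norm_num
  rcases this with h | h <;> rw [h]
  norm_num

theorem near {t : ℝ} (H0 : ∀ c : ℝ, 0 < c → Hit t 0 c) (x : unitInterval) (U : Set unitInterval)
    (hU : IsOpen U) (hx : x ∈ U) : ∃ y ∈ U, ∃ m : ℕ, compG^[m] (y : ℝ) = t := by
  obtain ⟨ε, hε, hb⟩ := Metric.isOpen_iff.1 hU x hx
  have hx0 := x.2.1
  have hx1 := x.2.2
  have hab : max 0 ((x:ℝ) - ε/2) < min 1 ((x:ℝ) + ε/2) := by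
    apply max_lt <;> apply lt_min <;> linarith
  obtain ⟨y, h1, h2, m, hm⟩ := hit_ab H0 _ _ (le_max_left _ _) (min_le_left _ _) hab
  rw [max_le_iff] at h1
  rw [le_min_iff] at h2
  refine ⟨⟨y, h1.1, h2.1⟩, hb ?_, m, hm⟩
  rw [Metric.mem_ball, Subtype.dist_eq, Real.dist_eq, abs_lt]
  constructor <;> simp only <;> linarith [h1.2, h2.2]

/-- The composition `f₂ ∘ f₁` is `F`-sensitive for the Furstenberg
family of all infinite subsets of `ℤ⁺`. -/
theorem composition_infinitely_sensitive :
    ∃ δ > (0 : ℝ), ∀ x : unitInterval, ∀ U : Set unitInterval, IsOpen U → x ∈ U →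
      ∃ y ∈ U,
        {n : ℕ | δ < dist ((tentF₂ ∘ tentF₁)^[n] x) ((tentF₂ ∘ tentF₁)^[n] y)}.Infinite := by
  refine ⟨1/10, by norm_num, fun x U hU hx => ?_⟩
  obtain ⟨y, hy, m, hm⟩ := near (t := 0)
    (fun c hc => ⟨0, le_rfl, hc.le, 0, rfl⟩) x U hU hx
  obtain ⟨z, hz, l, hl⟩ := near hit_half x U hU hx
  by_contra hcon
  push Not at hcon
  have hfin := (hcon y hy).union (hcon z hz)
  refine (Set.Ici_infinite (m + l)) (hfin.subset fun n hn => ?_)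
  rw [Set.mem_Ici] at hn
  obtain ⟨r, rfl⟩ := Nat.exists_eq_add_of_le hn
  have e1 : compG^[m + l + r] (y : ℝ) ≤ 1/4 := by
    rw [show m + l + r = (l + r) + m by ring, Function.iterate_add_apply, hm]
    exact iter_zero _
  have e2 : compG^[m + l + r] (z : ℝ) = 1/2 := by
    rw [show m + l + r = (m + r) + l by ring, Function.iterate_add_apply, hl]
    exact iter_half _
  by_contra hno
  simp only [Set.mem_union, Set.mem_ofPred_eq, not_or, not_lt, Subtype.dist_eq, Real.dist_eq,
    coe_iter, abs_le] at hno
  obtain ⟨⟨_, _⟩, ⟨_, _⟩⟩ := hno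
  linarith
end

section
/- Let f_1, f_2 : [0,1] → [0,1] be the piecewise linear maps defined by f_1(x) = 4x for x ∈ [0, 1/4] and f_1(x) = 5/4 − x for x ∈ [1/4, 1]; f_2(x) = 1/4 − x for x ∈ [0, 1/4], f_2(x) = 4x − 1 for x ∈ [1/4, 1/2], and f_2(x) = 2 − 2x for x ∈ [1/2, 1]. Then [1/4, 1] is an invariant set for f_1 (f_1([1/4,1]) ⊆ [1/4,1]) and [0, 1/4] is an invariant set for f_2 (f_2([0,1/4]) ⊆ [0,1/4]); consequently, neither f_1 nor f_2 is F-sensitive for the Furstenberg family F of all infinite subsets of ℤ⁺. -/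
open unitInterval

theorem iterate_dist_aux (f : unitInterval → unitInterval) (A : Set unitInterval)
    (hA : Set.MapsTo f A A) (hd : ∀ x ∈ A, ∀ y ∈ A, dist (f x) (f y) = dist x y) (n : ℕ) :
    ∀ x ∈ A, ∀ y ∈ A, dist (f^[n] x) (f^[n] y) = dist x y := by
  induction n with
  | zero => intro x _ y _; rfl
  | succ n ih =>
    intro x hx y hy
    rw [Function.iterate_succ_apply, Function.iterate_succ_apply, ih _ (hA hx) _ (hA hy),
      hd x hx y hy]

theorem not_sensitive_aux (f : unitInterval → unitInterval) (A V : Set unitInterval)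
    (hA : Set.MapsTo f A A) (hd : ∀ x ∈ A, ∀ y ∈ A, dist (f x) (f y) = dist x y)
    (hV : IsOpen V) (hVA : V ⊆ A) (x : unitInterval) (hx : x ∈ V) :
    ¬ (∃ δ > (0 : ℝ), ∀ x : unitInterval, ∀ U : Set unitInterval, IsOpen U → x ∈ U →
        ∃ y ∈ U, {n : ℕ | δ < dist (f^[n] x) (f^[n] y)}.Infinite) := by
  rintro ⟨δ, hδ, h⟩
  obtain ⟨y, ⟨hyV, hyb⟩, hinf⟩ := h x (V ∩ Metric.ball x δ) (hV.inter Metric.isOpen_ball)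
    ⟨hx, Metric.mem_ball_self hδ⟩
  obtain ⟨n, hn⟩ := hinf.nonempty
  rw [Set.mem_ofPred_eq, iterate_dist_aux f A hA hd n x (hVA hx) y (hVA hyV), dist_comm] at hn
  exact absurd hn (not_lt.mpr (le_of_lt hyb))

theorem tentF₁_coe (x : unitInterval) (hx : 1/4 ≤ (x : ℝ)) :
    ((tentF₁ x : unitInterval) : ℝ) = 5/4 - (x : ℝ) := by
  simp only [tentF₁]
  split_ifs <;> linarith

theorem tentF₂_coe (x : unitInterval) (hx : (x : ℝ) ≤ 1/4) :
    ((tentF₂ x : unitInterval) : ℝ) = 1/4 - (x : ℝ) := by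
  simp only [tentF₂]
  rw [if_pos hx]

/-- `[1/4, 1]` is invariant for `f₁` and `[0, 1/4]` is invariant for
`f₂`; consequently neither `f₁` nor `f₂` is `F`-sensitive for the Furstenberg family of
all infinite subsets of `ℤ⁺`. -/
theorem tent_maps_not_infinitely_sensitive :
    Set.MapsTo tentF₁ {x : unitInterval | 1/4 ≤ (x : ℝ)} {x : unitInterval | 1/4 ≤ (x : ℝ)} ∧
    Set.MapsTo tentF₂ {x : unitInterval | (x : ℝ) ≤ 1/4} {x : unitInterval | (x : ℝ) ≤ 1/4} ∧
    ¬ (∃ δ > (0 : ℝ), ∀ x : unitInterval, ∀ U : Set unitInterval, IsOpen U → x ∈ U →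
        ∃ y ∈ U, {n : ℕ | δ < dist (tentF₁^[n] x) (tentF₁^[n] y)}.Infinite) ∧
    ¬ (∃ δ > (0 : ℝ), ∀ x : unitInterval, ∀ U : Set unitInterval, IsOpen U → x ∈ U →
        ∃ y ∈ U, {n : ℕ | δ < dist (tentF₂^[n] x) (tentF₂^[n] y)}.Infinite) := by
  have h1 : Set.MapsTo tentF₁ {x : unitInterval | 1/4 ≤ (x : ℝ)}
      {x : unitInterval | 1/4 ≤ (x : ℝ)} := by
    intro x hx
    have := tentF₁_coe x hx
    have := x.2.2
    simp only [Set.mem_ofPred_eq] at *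
    linarith
  have h2 : Set.MapsTo tentF₂ {x : unitInterval | (x : ℝ) ≤ 1/4}
      {x : unitInterval | (x : ℝ) ≤ 1/4} := by
    intro x hx
    have := tentF₂_coe x hx
    have := x.2.1
    simp only [Set.mem_ofPred_eq] at *
    linarith
  refine ⟨h1, h2, ?_, ?_⟩
  · refine not_sensitive_aux tentF₁ _ {x : unitInterval | 1/4 < (x : ℝ)} h1 ?_
      (isOpen_lt continuous_const continuous_subtype_val) (fun x hx => by
        simp only [Set.mem_ofPred_eq] at *; exact le_of_lt hx) 1 ?_
    · intro x hx y hy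
      rw [Subtype.dist_eq, Subtype.dist_eq, tentF₁_coe x hx, tentF₁_coe y hy, dist_sub_left]
    · simp only [Set.mem_ofPred_eq, Set.Icc.coe_one]
      norm_num
  · refine not_sensitive_aux tentF₂ _ {x : unitInterval | (x : ℝ) < 1/4} h2 ?_
      (isOpen_lt continuous_subtype_val continuous_const) (fun x hx => by
        simp only [Set.mem_ofPred_eq] at *; exact le_of_lt hx) 0 ?_
    · intro x hx y hy
      rw [Subtype.dist_eq, Subtype.dist_eq, tentF₂_coe x hx, tentF₂_coe y hy, dist_sub_left]
    · simp only [Set.mem_ofPred_eq, Set.Icc.coe_zero]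
      norm_num
end
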